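/- Let G : ℝⁿ → [0, ∞) be an integrable symmetric decreasing function and ψ : ℝⁿ → [0, ∞) an integrable Borel measurable function vanishing at infinity with ∫_{B^r} ψ*(x) dx ≤ ∫_{B^r} G(x) dx for all r ≥ 0, where B^r is the ball of radius r centered at the origin and ψ* is the symmetric decreasing rearrangement of ψ. Then there exists a symmetric decreasing Borel measurable function w : ℝⁿ → [0, 1] such that ∫_{ℝⁿ} w(x) G(x) dx = ∫_{ℝⁿ} ψ(x) dx and ∫_{B^r} w(x) G(x) dx ≥ ∫_{B^r} ψ*(x) dx for all r ≥ 0. -/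

import Mathlib

open MeasureTheory ENNReal

/-- `fs` is the symmetric decreasing rearrangement of the non-negative function `f` on ℝⁿ:
for every `t > 0`, the superlevel set `{fs > t}` is an open ball centered at the origin
whose Lebesgue measure equals that of `{f > t}`. -/
def IsSymmDecrRearrangement {n : ℕ}
    (f fs : EuclideanSpace ℝ (Fin n) → ℝ≥0∞) : Prop :=
  ∀ t : ℝ≥0∞, 0 < t → ∃ r : ℝ,
    {x | t < fs x} = Metric.ball (0 : EuclideanSpace ℝ (Fin n)) r ∧
    volume (Metric.ball (0 : EuclideanSpace ℝ (Fin n)) r) = volume {x | t < f x}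

/-- A non-negative real function on ℝⁿ is symmetric decreasing if its value depends only on
the Euclidean norm and is non-increasing in the norm. -/
def SymmetricDecreasing {n : ℕ} (p : EuclideanSpace ℝ (Fin n) → ℝ) : Prop :=
  ∀ x y : EuclideanSpace ℝ (Fin n), ‖x‖ ≤ ‖y‖ → p y ≤ p x

/-- Layer cake formula for an extended non-negative function that is almost everywhere finite. -/
lemma lintegral_eq_lintegral_meas_ofReal_lt {α : Type*} [MeasurableSpace α] {μ : Measure α}
    {f : α → ℝ≥0∞} (hf : Measurable f) (hfin : ∀ᵐ x ∂μ, f x ≠ ∞) :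
    ∫⁻ x, f x ∂μ = ∫⁻ t in Set.Ioi (0 : ℝ), μ {x | ENNReal.ofReal t < f x} := by
  have h := lintegral_eq_lintegral_meas_lt μ (f := fun x => (f x).toReal)
    (Filter.Eventually.of_forall fun x => ENNReal.toReal_nonneg) hf.ennreal_toReal.aemeasurable
  calc ∫⁻ x, f x ∂μ = ∫⁻ x, ENNReal.ofReal (f x).toReal ∂μ :=
        lintegral_congr_ae (hfin.mono fun x hx => (ENNReal.ofReal_toReal hx).symm)
    _ = _ := h
    _ = _ := by
        refine setLIntegral_congr_fun measurableSet_Ioi fun t ht => measure_congr ?_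
        filter_upwards [hfin] with x hx
        exact propext (ENNReal.ofReal_lt_iff_lt_toReal (le_of_lt ht) hx).symm

lemma IsSymmDecrRearrangement.measure_lt {n : ℕ} {f fs : EuclideanSpace ℝ (Fin n) → ℝ≥0∞}
    (h : IsSymmDecrRearrangement f fs) {t : ℝ≥0∞} (ht : 0 < t) :
    volume {x | t < fs x} = volume {x | t < f x} := by
  obtain ⟨r, hr, hv⟩ := h t ht
  rw [hr, hv]

lemma IsSymmDecrRearrangement.measurable {n : ℕ} {f fs : EuclideanSpace ℝ (Fin n) → ℝ≥0∞}
    (h : IsSymmDecrRearrangement f fs) : Measurable fs := by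
  refine measurable_of_Ioi fun t => ?_
  have hpos : ∀ t : ℝ≥0∞, 0 < t → MeasurableSet {x | t < fs x} := fun t ht => by
    obtain ⟨r, hr, -⟩ := h t ht
    exact hr ▸ measurableSet_ball
  rcases eq_or_ne t 0 with rfl | ht
  · have : fs ⁻¹' Set.Ioi 0 = ⋃ k : ℕ, {x | ((k : ℝ≥0∞) + 1)⁻¹ < fs x} := by
      ext x
      simp only [Set.mem_preimage, Set.mem_Ioi, Set.mem_iUnion, Set.mem_ofPred_eq]
      refine ⟨fun hx => ?_, fun ⟨k, hk⟩ => bot_le.trans_lt hk⟩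
      obtain ⟨k, hk⟩ := ENNReal.exists_inv_nat_lt hx.ne'
      exact ⟨k, (ENNReal.inv_le_inv.2 le_self_add).trans_lt hk⟩
    rw [this]
    exact MeasurableSet.iUnion fun k => hpos _ (by simp)
  · exact hpos t (pos_iff_ne_zero.2 ht)

/-- Rearrangement preserves the integral of an integrable function. -/
lemma IsSymmDecrRearrangement.lintegral_eq {n : ℕ} {f fs : EuclideanSpace ℝ (Fin n) → ℝ≥0∞}
    (h : IsSymmDecrRearrangement f fs) (hf : Measurable f) (hfi : ∫⁻ x, f x ≠ ∞) :
    ∫⁻ x, fs x = ∫⁻ x, f x := by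
  have hfin : ∀ᵐ x, fs x ≠ ∞ := by
    rw [ae_iff]
    have hle : ∀ k : ℕ, volume {x | ¬ fs x ≠ ∞} ≤ (∫⁻ x, f x) / ((k : ℝ≥0∞) + 1) := fun k => by
      have hk : (k : ℝ≥0∞) + 1 ≠ ∞ := by finiteness
      calc volume {x | ¬ fs x ≠ ∞} ≤ volume {x | (k : ℝ≥0∞) + 1 < fs x} := by
            refine measure_mono fun x hx => ?_
            have hx' : fs x = ∞ := not_not.1 hx
            simp [hx']
        _ = volume {x | (k : ℝ≥0∞) + 1 < f x} := h.measure_lt (by simp)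
        _ ≤ volume {x | (k : ℝ≥0∞) + 1 ≤ f x} := by
            gcongr with x
            exact le_of_lt
        _ ≤ _ := meas_ge_le_lintegral_div hf.aemeasurable (by simp) hk
    have hlim : Filter.Tendsto (fun k : ℕ => (∫⁻ x, f x) / ((k : ℝ≥0∞) + 1)) Filter.atTop
        (nhds 0) := by
      have h1 := (ENNReal.tendsto_inv_nat_nhds_zero.comp (Filter.tendsto_add_atTop_nat 1))
      simpa [div_eq_mul_inv] using ENNReal.Tendsto.const_mul h1 (Or.inr hfi)
    exact le_antisymm (ge_of_tendsto' hlim hle) bot_le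
  rw [lintegral_eq_lintegral_meas_ofReal_lt h.measurable hfin,
    lintegral_eq_lintegral_meas_ofReal_lt hf ((ae_lt_top hf hfi).mono fun x hx => hx.ne)]
  exact setLIntegral_congr_fun measurableSet_Ioi fun t ht =>
    h.measure_lt (ENNReal.ofReal_pos.2 ht)

/-- The integral over a centered ball depends continuously on the radius. -/
lemma continuous_setIntegral_ball {E : Type*} [NormedAddCommGroup E] [NormedSpace ℝ E]
    [FiniteDimensional ℝ E] [Nontrivial E] [MeasurableSpace E] [BorelSpace E] {μ : Measure E}
    [μ.IsAddHaarMeasure] {f : E → ℝ} (hf : Integrable f μ) :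
    Continuous fun r : ℝ => ∫ x in Metric.ball (0 : E) r, f x ∂μ := by
  simp_rw [← integral_indicator (measurableSet_ball (x := (0 : E)))]
  refine continuous_iff_continuousAt.2 fun r => ?_
  refine continuousAt_of_dominated (bound := fun x => ‖f x‖)
    (Filter.Eventually.of_forall fun s => hf.aestronglyMeasurable.indicator measurableSet_ball)
    (Filter.Eventually.of_forall fun s => Filter.Eventually.of_forall fun x =>
      norm_indicator_le_norm_self _ _) hf.norm ?_
  have hs : ∀ᵐ x ∂μ, x ∉ Metric.sphere (0 : E) r :=
    measure_eq_zero_iff_ae_notMem.1 (Measure.addHaar_sphere μ 0 r)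
  filter_upwards [hs] with x hx
  have hx' : ‖x‖ ≠ r := by simpa using hx
  rcases hx'.lt_or_gt with hlt | hlt
  · refine (continuousAt_const (y := f x)).congr ?_
    filter_upwards [lt_mem_nhds hlt] with s hs
    rw [Set.indicator_of_mem (by simpa using hs)]
  · refine (continuousAt_const (y := (0 : ℝ))).congr ?_
    filter_upwards [gt_mem_nhds hlt] with s hs
    rw [Set.indicator_of_notMem (by simpa using le_of_lt hs)]

/-- Every mass not exceeding that of `G` is the mass of `w * G` for a symmetric decreasing `w`
concentrating as much of it as possible near the origin. -/
lemma exists_symmetricDecreasing_integral_mul_eq {n : ℕ} {G : EuclideanSpace ℝ (Fin n) → ℝ}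
    (hGi : Integrable G volume) {m : ℝ} (hm0 : 0 ≤ m) (hm : m ≤ ∫ x, G x) :
    ∃ w : EuclideanSpace ℝ (Fin n) → ℝ,
      Measurable w ∧ (∀ x, w x ∈ Set.Icc (0 : ℝ) 1) ∧ SymmetricDecreasing w ∧
      (∫ x, w x * G x) = m ∧
      ∀ r : ℝ, 0 ≤ r → (∀ x ∈ Metric.ball (0 : EuclideanSpace ℝ (Fin n)) r, w x = 1) ∨
        ∀ x ∉ Metric.ball (0 : EuclideanSpace ℝ (Fin n)) r, w x = 0 := by
  rcases eq_or_lt_of_le hm with rfl | hlt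
  · exact ⟨fun _ => 1, measurable_const, fun _ => by simp, fun _ _ _ => le_rfl, by simp,
      fun r _ => Or.inl fun _ _ => rfl⟩
  rcases n with _ | n
  · refine ⟨fun _ => m / ∫ x, G x, measurable_const, fun _ => ⟨div_nonneg hm0 (hm0.trans hm),
      div_le_one_of_le₀ hm (hm0.trans hm)⟩, fun _ _ _ => le_rfl, ?_, fun r hr => ?_⟩
    · rw [integral_const_mul, div_mul_cancel₀ _ (hm0.trans_lt hlt).ne']
    · rcases hr.eq_or_lt with rfl | hr
      · exact Or.inl fun x hx => by simp at hx
      · exact Or.inr fun x hx => absurd (by simpa [Subsingleton.elim x 0] using hr) hx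
  · set F : ℝ → ℝ := fun r => ∫ x in Metric.ball (0 : EuclideanSpace ℝ (Fin (n + 1))) r, G x
    have hF : Continuous F := continuous_setIntegral_ball hGi
    have hlim : Filter.Tendsto F Filter.atTop (nhds (∫ x, G x)) :=
      (aecover_ball (x := (0 : EuclideanSpace ℝ (Fin (n + 1))))
        Filter.tendsto_id).integral_tendsto_of_countably_generated hGi
    obtain ⟨s, hs, hs0⟩ :=
      ((hlim.eventually (lt_mem_nhds hlt)).and (Filter.eventually_ge_atTop 0)).exists
    obtain ⟨R, -, hR⟩ := intermediate_value_Icc hs0 hF.continuousOn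
      (show m ∈ Set.Icc (F 0) (F s) from ⟨by simpa [F] using hm0, le_of_lt hs⟩)
    refine ⟨(Metric.ball 0 R).indicator 1, measurable_one.indicator measurableSet_ball,
      fun x => ?_, fun x y hxy => ?_, ?_, fun r _ => ?_⟩
    · by_cases hx : x ∈ Metric.ball (0 : EuclideanSpace ℝ (Fin (n + 1))) R <;> simp [hx]
    · by_cases hy : y ∈ Metric.ball (0 : EuclideanSpace ℝ (Fin (n + 1))) R
      · have hx : x ∈ Metric.ball (0 : EuclideanSpace ℝ (Fin (n + 1))) R := by
          rw [mem_ball_zero_iff] at hy ⊢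
          exact hxy.trans_lt hy
        simp [hx, hy]
      · rw [Set.indicator_of_notMem hy]
        exact Set.indicator_nonneg (fun _ _ => zero_le_one) x
    · rw [← hR, show F R = _ from (integral_indicator measurableSet_ball).symm]
      refine integral_congr_ae (Filter.Eventually.of_forall fun x => ?_)
      by_cases hx : x ∈ Metric.ball (0 : EuclideanSpace ℝ (Fin (n + 1))) R
      · simp only [Set.indicator_of_mem hx, Pi.one_apply, one_mul]
      · simp only [Set.indicator_of_notMem hx, zero_mul]
    · rcases le_total r R with h | h
      · exact Or.inl fun x hx => Set.indicator_of_mem (Metric.ball_subset_ball h hx) _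
      · exact Or.inr fun x hx =>
          Set.indicator_of_notMem (fun hx' => hx (Metric.ball_subset_ball h hx')) _

/-- Let `G` be an integrable symmetric decreasing function and `ψ` an
integrable non-negative Borel function vanishing at infinity whose rearrangement `ψs`
satisfies `∫_{B^r} ψs ≤ ∫_{B^r} G` for all `r ≥ 0`. Then there is a symmetric decreasing
Borel measurable `w : ℝⁿ → [0, 1]` with `∫ w G = ∫ ψ` and `∫_{B^r} w G ≥ ∫_{B^r} ψs`
for all `r ≥ 0`. (Existence of the symmetric decreasing triggering probability.) -/
theorem exists_symmetric_decreasing_weight {n : ℕ}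
    (G ψ : EuclideanSpace ℝ (Fin n) → ℝ)
    (hG0 : ∀ x, 0 ≤ G x) (hψ0 : ∀ x, 0 ≤ ψ x)
    (hGsd : SymmetricDecreasing G) (hGi : Integrable G volume)
    (hψm : Measurable ψ) (hψi : Integrable ψ volume)
    (hψv : ∀ t : ℝ, 0 < t → volume {x | t < ψ x} < ∞)
    (ψs : EuclideanSpace ℝ (Fin n) → ℝ≥0∞)
    (hψs : IsSymmDecrRearrangement (fun x => ENNReal.ofReal (ψ x)) ψs)
    (hball : ∀ r : ℝ, 0 ≤ r →
      ∫⁻ x in Metric.ball (0 : EuclideanSpace ℝ (Fin n)) r, ψs x ∂volume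
        ≤ ∫⁻ x in Metric.ball (0 : EuclideanSpace ℝ (Fin n)) r,
            ENNReal.ofReal (G x) ∂volume) :
    ∃ w : EuclideanSpace ℝ (Fin n) → ℝ,
      Measurable w ∧ (∀ x, w x ∈ Set.Icc (0 : ℝ) 1) ∧ SymmetricDecreasing w ∧
      (∫ x, w x * G x ∂volume) = (∫ x, ψ x ∂volume) ∧
      (∀ r : ℝ, 0 ≤ r →
        ∫⁻ x in Metric.ball (0 : EuclideanSpace ℝ (Fin n)) r, ψs x ∂volume
          ≤ ∫⁻ x in Metric.ball (0 : EuclideanSpace ℝ (Fin n)) r,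
              ENNReal.ofReal (w x * G x) ∂volume) := by
  have hψI : ∫⁻ x, ENNReal.ofReal (ψ x) = ENNReal.ofReal (∫ x, ψ x) :=
    (ofReal_integral_eq_lintegral_ofReal hψi (Filter.Eventually.of_forall hψ0)).symm
  have hGI : ∫⁻ x, ENNReal.ofReal (G x) = ENNReal.ofReal (∫ x, G x) :=
    (ofReal_integral_eq_lintegral_ofReal hGi (Filter.Eventually.of_forall hG0)).symm
  have hmass : ∫⁻ x, ψs x = ENNReal.ofReal (∫ x, ψ x) :=
    (hψs.lintegral_eq hψm.ennreal_ofReal (hψI ▸ ENNReal.ofReal_ne_top)).trans hψI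
  have hlim := (aecover_ball (μ := volume) (x := (0 : EuclideanSpace ℝ (Fin n)))
    Filter.tendsto_id).lintegral_tendsto_of_countably_generated hψs.measurable.aemeasurable
  have hle : ∫⁻ x, ψs x ≤ ∫⁻ x, ENNReal.ofReal (G x) :=
    le_of_tendsto hlim ((Filter.eventually_ge_atTop 0).mono fun r hr =>
      (hball r hr).trans (setLIntegral_le_lintegral _ _))
  rw [hmass, hGI, ENNReal.ofReal_le_ofReal_iff (integral_nonneg hG0)] at hle
  obtain ⟨w, hwm, hw01, hwsd, hwG, hw⟩ :=
    exists_symmetricDecreasing_integral_mul_eq hGi (integral_nonneg hψ0) hle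
  refine ⟨w, hwm, hw01, hwsd, hwG, fun r hr => ?_⟩
  rcases hw r hr with h | h
  · refine (hball r hr).trans_eq (setLIntegral_congr_fun measurableSet_ball fun x hx => ?_)
    simp [h x hx]
  · have hwGi : Integrable (fun x => w x * G x) volume :=
      hGi.bdd_mul (c := 1) hwm.aestronglyMeasurable (Filter.Eventually.of_forall fun x => by
        rw [Real.norm_eq_abs, abs_of_nonneg (hw01 x).1]
        exact (hw01 x).2)
    have hsupp : Function.support (fun x => ENNReal.ofReal (w x * G x)) ⊆ Metric.ball 0 r :=
      fun x hx => by
        by_contra hxr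
        exact hx (by simp [h x hxr])
    calc _ ≤ ∫⁻ x, ψs x := setLIntegral_le_lintegral _ _
      _ = ENNReal.ofReal (∫ x, w x * G x) := by rw [hmass, hwG]
      _ = ∫⁻ x, ENNReal.ofReal (w x * G x) := ofReal_integral_eq_lintegral_ofReal hwGi
          (Filter.Eventually.of_forall fun x => mul_nonneg (hw01 x).1 (hG0 x))
      _ = _ := (setLIntegral_eq_of_support_subset hsupp).symm
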